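/- Let Γ be an inverse semigroup, let x, y ∈ Γ, and let Z ⊆ Γ be a directed set such that some c ∈ Z satisfies c ≺ x·y. Put X := Z·{y⁻¹} and Y := {x⁻¹}·Z. Then: some a ∈ X satisfies a ≺ x; some b ∈ Y satisfies b ≺ y; X·Y ∼ Z; and X⁻¹·X ∼ Y·Y⁻¹. (This is the multiplicativity U_{xy} = U_x·U_y of the map U: Γ → S(G_u(Γ)).) -/

import Mathlib

/-- An inverse semigroup: a semigroup in which every element `x` has a unique
element `x⁻¹` with `x * x⁻¹ * x = x` and `x⁻¹ * x * x⁻¹ = x⁻¹`. -/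
class InverseSemigroup (α : Type*) extends Semigroup α, Inv α where
  mul_inv_mul : ∀ x : α, x * x⁻¹ * x = x
  inv_mul_inv : ∀ x : α, x⁻¹ * x * x⁻¹ = x⁻¹
  inv_unique : ∀ x y : α, x * y * x = x → y * x * y = y → y = x⁻¹

variable {α : Type*} [InverseSemigroup α]

/-- The natural order on an inverse semigroup: `x ≺ y` iff `x * y⁻¹ = x * x⁻¹`. -/
def prec (x y : α) : Prop := x * y⁻¹ = x * x⁻¹

/-- The idempotents (units) `Γ⁽⁰⁾`: elements `p` with `p = p * p⁻¹`. -/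
def IsIdem (p : α) : Prop := p = p * p⁻¹

/-- A zero element: `z * x = z = x * z` for every `x`. -/
def IsZeroEl (z : α) : Prop := ∀ x : α, z * x = z ∧ x * z = z


/-- A subset A is directed if any two of its elements have a common
precessor in A. -/
def IsDirectedSet (A : Set α) : Prop :=
  ∀ a ∈ A, ∀ b ∈ A, ∃ c ∈ A, prec c a ∧ prec c b

/-- Elementwise product of two subsets. -/
def mulSet (A B : Set α) : Set α := {x | ∃ a ∈ A, ∃ b ∈ B, x = a * b}

/-- Elementwise inverse of a subset. -/
def invSet (A : Set α) : Set α := {x | ∃ a ∈ A, x = a⁻¹}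

/-- A ≼ B iff every b ∈ B has some a ∈ A with a ≺ b. -/
def sprec (A B : Set α) : Prop := ∀ b ∈ B, ∃ a ∈ A, prec a b

/-- A ∼ B iff A ≼ B and B ≼ A. -/
def sequiv (A B : Set α) : Prop := sprec A B ∧ sprec B A


namespace InverseSemigroup

theorem inv_inv' (x : α) : x⁻¹⁻¹ = x :=
  (inv_unique x⁻¹ x (inv_mul_inv x) (mul_inv_mul x)).symm

theorem mul_inv_mul_assoc (x : α) : x * (x⁻¹ * x) = x := by
  rw [← mul_assoc, mul_inv_mul]

theorem isIdempotentElem_mul_inv (x : α) : IsIdempotentElem (x * x⁻¹) := by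
  rw [IsIdempotentElem, ← mul_assoc, mul_inv_mul]

theorem isIdempotentElem_inv_mul (x : α) : IsIdempotentElem (x⁻¹ * x) := by
  rw [IsIdempotentElem, ← mul_assoc, inv_mul_inv]

theorem inv_eq_self {e : α} (he : IsIdempotentElem e) : e⁻¹ = e :=
  (inv_unique e e (by rw [he.eq, he.eq]) (by rw [he.eq, he.eq])).symm

theorem isIdempotentElem_mul {e f : α} (he : IsIdempotentElem e) (hf : IsIdempotentElem f) :
    IsIdempotentElem (e * f) := by
  have key : f * (e * f)⁻¹ * e = (e * f)⁻¹ := by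
    apply inv_unique
    · calc e * f * (f * (e * f)⁻¹ * e) * (e * f)
          = e * (f * f) * (e * f)⁻¹ * (e * e * f) := by simp only [mul_assoc]
        _ = e * f := by rw [he.eq, hf.eq, mul_inv_mul]
    · calc f * (e * f)⁻¹ * e * (e * f) * (f * (e * f)⁻¹ * e)
          = f * ((e * f)⁻¹ * (e * e * (f * f)) * (e * f)⁻¹) * e := by simp only [mul_assoc]
        _ = f * (e * f)⁻¹ * e := by rw [he.eq, hf.eq, inv_mul_inv]
  have hg : IsIdempotentElem (e * f)⁻¹ := by
    calc (e * f)⁻¹ * (e * f)⁻¹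
        = f * (e * f)⁻¹ * e * (f * (e * f)⁻¹ * e) := by rw [key]
      _ = f * ((e * f)⁻¹ * (e * f) * (e * f)⁻¹) * e := by simp only [mul_assoc]
      _ = (e * f)⁻¹ := by rw [inv_mul_inv, key]
  have h := inv_eq_self hg
  rw [inv_inv'] at h
  rwa [h]

theorem idempotents_commute {e f : α} (he : IsIdempotentElem e) (hf : IsIdempotentElem f) :
    e * f = f * e := by
  have hef := isIdempotentElem_mul he hf
  have hfe := isIdempotentElem_mul hf he
  have h : f * e = (e * f)⁻¹ := by
    apply inv_unique
    · calc e * f * (f * e) * (e * f) = e * (f * f) * (e * e) * f := by simp only [mul_assoc]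
        _ = e * f * (e * f) := by rw [he.eq, hf.eq, mul_assoc (e * f)]
        _ = e * f := hef.eq
    · calc f * e * (e * f) * (f * e) = f * (e * e) * (f * f) * e := by simp only [mul_assoc]
        _ = f * e * (f * e) := by rw [he.eq, hf.eq, mul_assoc (f * e)]
        _ = f * e := hfe.eq
  rw [h, inv_eq_self hef]

theorem mul_inv_rev' (x y : α) : (x * y)⁻¹ = y⁻¹ * x⁻¹ := by
  have hcomm := idempotents_commute (isIdempotentElem_mul_inv y) (isIdempotentElem_inv_mul x)
  refine (inv_unique _ _ ?_ ?_).symm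
  · calc x * y * (y⁻¹ * x⁻¹) * (x * y) = x * (y * y⁻¹ * (x⁻¹ * x)) * y := by
          simp only [mul_assoc]
      _ = x * x⁻¹ * x * (y * y⁻¹ * y) := by rw [hcomm]; simp only [mul_assoc]
      _ = x * y := by rw [mul_inv_mul, mul_inv_mul]
  · calc y⁻¹ * x⁻¹ * (x * y) * (y⁻¹ * x⁻¹) = y⁻¹ * (x⁻¹ * x * (y * y⁻¹)) * x⁻¹ := by
          simp only [mul_assoc]
      _ = y⁻¹ * y * y⁻¹ * (x⁻¹ * x * x⁻¹) := by rw [← hcomm]; simp only [mul_assoc]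
      _ = y⁻¹ * x⁻¹ := by rw [inv_mul_inv, inv_mul_inv]

theorem isIdempotentElem_conj {e : α} (he : IsIdempotentElem e) (x : α) :
    IsIdempotentElem (x * e * x⁻¹) := by
  calc x * e * x⁻¹ * (x * e * x⁻¹) = x * (e * (x⁻¹ * x)) * (e * x⁻¹) := by
        simp only [mul_assoc]
    _ = x * x⁻¹ * x * (e * e) * x⁻¹ := by
        rw [idempotents_commute he (isIdempotentElem_inv_mul x)]; simp only [mul_assoc]
    _ = x * e * x⁻¹ := by rw [mul_inv_mul, he.eq]

theorem prec_idempotent_mul {e : α} (he : IsIdempotentElem e) (y : α) : prec (e * y) y := by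
  have hcomm := idempotents_commute he (isIdempotentElem_mul_inv y)
  calc e * y * y⁻¹ = e * e * (y * y⁻¹) := by rw [he.eq, mul_assoc]
    _ = e * (y * y⁻¹ * e) := by rw [← hcomm, mul_assoc]
    _ = e * y * (e * y)⁻¹ := by rw [mul_inv_rev', inv_eq_self he]; simp only [mul_assoc]

theorem mul_idempotent_eq {f : α} (hf : IsIdempotentElem f) (y : α) :
    y * f = y * f * y⁻¹ * y := by
  calc y * f = y * (y⁻¹ * y * f) := by rw [← mul_assoc, mul_inv_mul_assoc]
    _ = y * f * y⁻¹ * y := by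
      rw [← idempotents_commute hf (isIdempotentElem_inv_mul y)]; simp only [mul_assoc]

theorem prec_mul_idempotent {f : α} (hf : IsIdempotentElem f) (y : α) : prec (y * f) y := by
  rw [mul_idempotent_eq hf]
  exact prec_idempotent_mul (isIdempotentElem_conj hf y) y

theorem eq_mul_of_prec {x y : α} (h : prec x y) : x = y * (x⁻¹ * x) := by
  have h' : y * x⁻¹ = x * x⁻¹ := by
    simpa only [mul_inv_rev', inv_inv'] using congrArg (·⁻¹) (show x * y⁻¹ = x * x⁻¹ from h)
  rw [← mul_assoc, h', mul_inv_mul]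

theorem exists_eq_idempotent_mul_of_prec {x y : α} (h : prec x y) :
    ∃ e, IsIdempotentElem e ∧ x = e * y :=
  ⟨_, isIdempotentElem_conj (isIdempotentElem_inv_mul x) y,
    (eq_mul_of_prec h).trans (mul_idempotent_eq (isIdempotentElem_inv_mul x) y)⟩

theorem prec_refl (x : α) : prec x x := rfl

theorem prec_trans {x y z : α} (hxy : prec x y) (hyz : prec y z) : prec x z := by
  obtain ⟨e, he, rfl⟩ := exists_eq_idempotent_mul_of_prec hxy
  obtain ⟨f, hf, rfl⟩ := exists_eq_idempotent_mul_of_prec hyz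
  rw [← mul_assoc]
  exact prec_idempotent_mul (isIdempotentElem_mul he hf) z

theorem prec_mul {a b c d : α} (hab : prec a b) (hcd : prec c d) : prec (a * c) (b * d) := by
  obtain ⟨e, he, rfl⟩ := exists_eq_idempotent_mul_of_prec hab
  rw [eq_mul_of_prec hcd]
  refine prec_trans (y := b * d * (c⁻¹ * c)) ?_
    (prec_mul_idempotent (isIdempotentElem_inv_mul c) _)
  rw [mul_assoc e, ← mul_assoc b]
  exact prec_idempotent_mul he _

theorem prec_inv {a b : α} (h : prec a b) : prec a⁻¹ b⁻¹ := by
  obtain ⟨e, he, rfl⟩ := exists_eq_idempotent_mul_of_prec h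
  rw [mul_inv_rev', inv_eq_self he]
  exact prec_mul_idempotent he _

theorem mul_inv_mul_of_prec {x y : α} (h : prec x y) : x * y⁻¹ * x = x := by
  rw [show x * y⁻¹ = x * x⁻¹ from h, mul_inv_mul]

theorem prec_mul_inv_right {x y d : α} (h : prec d (x * y)) : prec (d * y⁻¹) x := by
  refine prec_trans (prec_mul h (prec_refl y⁻¹)) ?_
  rw [mul_assoc]
  exact prec_mul_idempotent (isIdempotentElem_mul_inv y) x

theorem prec_inv_mul_left {x y d : α} (h : prec d (x * y)) : prec (x⁻¹ * d) y := by
  refine prec_trans (prec_mul (prec_refl x⁻¹) h) ?_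
  rw [← mul_assoc]
  exact prec_idempotent_mul (isIdempotentElem_inv_mul x) y

theorem inv_mul_eq_mul_inv_of_prec_mul {x y d : α} (h : prec d (x * y)) :
    (d * y⁻¹)⁻¹ * (d * y⁻¹) = x⁻¹ * d * (x⁻¹ * d)⁻¹ := by
  have hb : prec (x⁻¹ * d) y := prec_inv_mul_left h
  have hdd : y⁻¹ * (x⁻¹ * d) = d⁻¹ * d := by
    have h' : d⁻¹ * (x * y) = d⁻¹ * d := by simpa only [prec, inv_inv'] using prec_inv h
    simpa only [mul_inv_rev', inv_inv', mul_assoc] using congrArg (·⁻¹) h'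
  have hyb : y * (y⁻¹ * (x⁻¹ * d)) = x⁻¹ * d := by
    rw [eq_mul_of_prec hb]
    simp only [← mul_assoc, mul_inv_mul]
  calc (d * y⁻¹)⁻¹ * (d * y⁻¹) = y * (d⁻¹ * d) * y⁻¹ := by
        rw [mul_inv_rev', inv_inv']; simp only [mul_assoc]
    _ = x⁻¹ * d * y⁻¹ := by rw [← hdd, hyb]
    _ = x⁻¹ * d * (x⁻¹ * d)⁻¹ := hb

end InverseSemigroup

open InverseSemigroup

/-- multiplicativity U_{xy} = U_x · U_y. If the directed set Z has
an element c ≺ x·y, then with X := Z·{y⁻¹} and Y := {x⁻¹}·Z one has: some a ∈ X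
satisfies a ≺ x; some b ∈ Y satisfies b ≺ y; X·Y ∼ Z; and X⁻¹·X ∼ Y·Y⁻¹. -/
theorem stmt10 (x y : α) (Z : Set α) (hZ : IsDirectedSet Z)
    (hc : ∃ c ∈ Z, prec c (x * y)) :
    (∃ a ∈ mulSet Z {y⁻¹}, prec a x) ∧
    (∃ b ∈ mulSet {x⁻¹} Z, prec b y) ∧
    sequiv (mulSet (mulSet Z {y⁻¹}) (mulSet {x⁻¹} Z)) Z ∧
    sequiv (mulSet (invSet (mulSet Z {y⁻¹})) (mulSet Z {y⁻¹}))
           (mulSet (mulSet {x⁻¹} Z) (invSet (mulSet {x⁻¹} Z))) := by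
  have hlow : ∀ a ∈ Z, ∀ b ∈ Z, ∃ d ∈ Z, prec d a ∧ prec d b ∧ prec d (x * y) := by
    obtain ⟨c, hcZ, hcxy⟩ := hc
    intro a ha b hb
    obtain ⟨u, huZ, hua, hub⟩ := hZ a ha b hb
    obtain ⟨d, hdZ, hdu, hdc⟩ := hZ u huZ c hcZ
    exact ⟨d, hdZ, prec_trans hdu hua, prec_trans hdu hub, prec_trans hdc hcxy⟩
  refine ⟨?_, ?_, ⟨?_, ?_⟩, ?_, ?_⟩
  · obtain ⟨c, hcZ, hcxy⟩ := hc
    exact ⟨c * y⁻¹, ⟨c, hcZ, y⁻¹, rfl, rfl⟩, prec_mul_inv_right hcxy⟩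
  · obtain ⟨c, hcZ, hcxy⟩ := hc
    exact ⟨x⁻¹ * c, ⟨x⁻¹, rfl, c, hcZ, rfl⟩, prec_inv_mul_left hcxy⟩
  · intro z hz
    obtain ⟨d, hdZ, hdz, -, hd⟩ := hlow z hz z hz
    refine ⟨d * y⁻¹ * (x⁻¹ * d),
      ⟨_, ⟨d, hdZ, y⁻¹, rfl, rfl⟩, _, ⟨x⁻¹, rfl, d, hdZ, rfl⟩, rfl⟩, ?_⟩
    rwa [← mul_assoc, mul_assoc d, ← mul_inv_rev', mul_inv_mul_of_prec hd]
  · rintro _ ⟨_, ⟨z, hz, _, rfl, rfl⟩, _, ⟨_, rfl, w, hw, rfl⟩, rfl⟩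
    obtain ⟨d, hdZ, hdz, hdw, hd⟩ := hlow z hz w hw
    refine ⟨d, hdZ, ?_⟩
    have h := prec_mul (prec_mul hdz (prec_refl y⁻¹)) (prec_mul (prec_refl x⁻¹) hdw)
    rwa [← mul_assoc, mul_assoc d, ← mul_inv_rev', mul_inv_mul_of_prec hd] at h
  · rintro _ ⟨_, ⟨_, rfl, z, hz, rfl⟩, _, ⟨_, ⟨_, rfl, w, hw, rfl⟩, rfl⟩, rfl⟩
    obtain ⟨d, hdZ, hdz, hdw, hd⟩ := hlow z hz w hw
    have hX : d * y⁻¹ ∈ mulSet Z {y⁻¹} := ⟨d, hdZ, y⁻¹, rfl, rfl⟩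
    refine ⟨(d * y⁻¹)⁻¹ * (d * y⁻¹), ⟨_, ⟨_, hX, rfl⟩, _, hX, rfl⟩, ?_⟩
    rw [inv_mul_eq_mul_inv_of_prec_mul hd]
    exact prec_mul (prec_mul (prec_refl _) hdz) (prec_inv (prec_mul (prec_refl _) hdw))
  · rintro _ ⟨_, ⟨_, ⟨z, hz, _, rfl, rfl⟩, rfl⟩, _, ⟨w, hw, _, rfl, rfl⟩, rfl⟩
    obtain ⟨d, hdZ, hdz, hdw, hd⟩ := hlow z hz w hw
    have hY : x⁻¹ * d ∈ mulSet {x⁻¹} Z := ⟨x⁻¹, rfl, d, hdZ, rfl⟩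
    refine ⟨x⁻¹ * d * (x⁻¹ * d)⁻¹, ⟨_, hY, _, ⟨_, hY, rfl⟩, rfl⟩, ?_⟩
    rw [← inv_mul_eq_mul_inv_of_prec_mul hd]
    exact prec_mul (prec_inv (prec_mul hdz (prec_refl _))) (prec_mul hdw (prec_refl _))
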